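/- Let N ≥ 2 and let R^cl_N be the ℂ-subalgebra of the commutative polynomial ring ℂ[x_1, …, x_N, p_1, …, p_N] generated by the elements A_i^{cl} = Σ_{j=1}^N p_j (x_j p_i − x_i p_j) for 1 ≤ i ≤ N, M_{jk} = x_j p_k − x_k p_j for 1 ≤ j < k ≤ N, and p² = Σ_{i=1}^N p_i². Then the transcendence degree of R^cl_N over ℂ equals 2N − 1; specifically, the 2N − 1 elements p², M_{1i} (2 ≤ i ≤ N), M_{i,i+1} (2 ≤ i ≤ N−1), and A_1^{cl} are algebraically independent over ℂ, and every element of R^cl_N is algebraic over the subalgebra they generate. -/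

import Mathlib

/-!
STATEMENT 18: the transcendence degree of the algebra `R^cl_N` generated by the classical
Laplace–Runge–Lenz components, the classical angular momenta and `p²` equals `2N − 1`:
the `2N − 1` listed elements are algebraically independent and every element of `R^cl_N`
is algebraic over the subalgebra they generate.
-/

noncomputable section

open Finset MvPolynomial

/-- The polynomial ring `ℂ[x_1, …, x_N, p_1, …, p_N]`. -/
abbrev PR (N : ℕ) := MvPolynomial (Fin N ⊕ Fin N) ℂ

/-- The classical angular momentum `M_{jk} = x_j p_k − x_k p_j`. -/
def Mang {N : ℕ} (j k : Fin N) : PR N :=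
  X (Sum.inl j) * X (Sum.inr k) - X (Sum.inl k) * X (Sum.inr j)

/-- The classical Laplace–Runge–Lenz component `A_i^{cl} = Σ_j p_j (x_j p_i − x_i p_j)`. -/
def Acl {N : ℕ} (i : Fin N) : PR N :=
  ∑ j, X (Sum.inr j) * (X (Sum.inl j) * X (Sum.inr i) - X (Sum.inl i) * X (Sum.inr j))

/-- `p² = Σ_i p_i²`. -/
def psq (N : ℕ) : PR N := ∑ i, X (Sum.inr i) ^ 2

/-- The subalgebra `R^cl_N` generated by the `A_i^{cl}`, the `M_{jk}` (`j < k`) and `p²`. -/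
def Rcl (N : ℕ) : Subalgebra ℂ (PR N) :=
  Algebra.adjoin ℂ
    ({psq N} ∪ { q : PR N | ∃ i : Fin N, q = Acl i }
      ∪ { q : PR N | ∃ j k : Fin N, j < k ∧ q = Mang j k })

/-- Index type for the `2N − 1` distinguished elements: `p²`; `A_1^{cl}`;
`M_{1i}` for `2 ≤ i ≤ N`; `M_{i,i+1}` for `2 ≤ i ≤ N−1` (in 1-based notation). -/
abbrev Idx18 (N : ℕ) :=
  Unit ⊕ Unit ⊕ { j : Fin N // 1 ≤ (j : ℕ) } ⊕ { j : Fin N // 1 ≤ (j : ℕ) ∧ (j : ℕ) ≤ N - 2 }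

/-- The family of the `2N − 1` distinguished elements of `R^cl_N`. -/
def fam18 (N : ℕ) (hN : 2 ≤ N) : Idx18 N → PR N
  | Sum.inl _ => psq N
  | Sum.inr (Sum.inl _) => Acl ⟨0, by omega⟩
  | Sum.inr (Sum.inr (Sum.inl j)) => Mang ⟨0, by omega⟩ j.1
  | Sum.inr (Sum.inr (Sum.inr j)) => Mang j.1 ⟨(j.1 : ℕ) + 1, by omega⟩

section identities
variable {R : Type*} [CommRing R] {N : ℕ} (x p : Fin N → R)

lemma aux_A (i : Fin N) : ∑ j, p j * (x j * p i - x i * p j)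
    = (∑ j, x j * p j) * p i - x i * ∑ j, p j ^ 2 := by
  rw [sum_mul, mul_sum, ← sum_sub_distrib]
  exact sum_congr rfl fun j _ => by ring

lemma aux_AA (s q : R) : ∑ k, (s * p k - x k * q) ^ 2
    = s ^ 2 * (∑ k, p k ^ 2) - 2 * s * q * (∑ k, x k * p k) + q ^ 2 * ∑ k, x k ^ 2 := by
  rw [mul_sum, mul_sum, mul_sum, ← sum_sub_distrib, ← sum_add_distrib]
  exact sum_congr rfl fun j _ => by ring

lemma aux_MM : ∑ j, ∑ k, (x j * p k - x k * p j) ^ 2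
    = 2 * ((∑ k, x k ^ 2) * (∑ k, p k ^ 2) - (∑ k, x k * p k) ^ 2) := by
  have h : ∀ j, ∑ k, (x j * p k - x k * p j) ^ 2 = x j ^ 2 * (∑ k, p k ^ 2)
      - 2 * (∑ k, x k * p k) * (x j * p j) + (∑ k, x k ^ 2) * p j ^ 2 := fun j => by
    rw [aux_AA]; ring
  rw [sum_congr rfl fun j _ => h j, sum_add_distrib, sum_sub_distrib, ← sum_mul, ← mul_sum,
    ← mul_sum]
  ring

lemma aux_AM (j : Fin N) (s q : R) : ∑ i, (s * p i - x i * q) * (x i * p j - x j * p i)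
    = s * p j * (∑ k, x k * p k) - s * x j * (∑ k, p k ^ 2) - q * p j * (∑ k, x k ^ 2)
      + q * x j * (∑ k, x k * p k) := by
  rw [mul_sum, mul_sum, mul_sum, mul_sum, ← sum_sub_distrib, ← sum_sub_distrib,
    ← sum_add_distrib]
  exact sum_congr rfl fun j _ => by ring

lemma aux_quad (u v : Fin N → R) (a b : R) : ∑ k, (a * u k - b * v k) ^ 2
    = a ^ 2 * (∑ k, u k ^ 2) - 2 * a * b * (∑ k, u k * v k) + b ^ 2 * ∑ k, v k ^ 2 := by
  rw [mul_sum, mul_sum, mul_sum, ← sum_sub_distrib, ← sum_add_distrib]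
  exact sum_congr rfl fun j _ => by ring

end identities

/-- `x² p² - (x·p)²`. -/
def Dis (N : ℕ) : PR N :=
  (∑ k, X (Sum.inl k) ^ 2) * (∑ k, X (Sum.inr k) ^ 2) - (∑ k, X (Sum.inl k) * X (Sum.inr k)) ^ 2

lemma Acl_eq {N : ℕ} (i : Fin N) : (Acl i : PR N)
    = (∑ j, X (Sum.inl j) * X (Sum.inr j)) * X (Sum.inr i) - X (Sum.inl i) * psq N :=
  aux_A (fun j => (X (Sum.inl j) : PR N)) (fun j => X (Sum.inr j)) i

lemma sum_Mang_sq (N : ℕ) : ∑ j : Fin N, ∑ k, (Mang j k : PR N) ^ 2 = 2 * Dis N :=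
  aux_MM (fun j => (X (Sum.inl j) : PR N)) (fun j => X (Sum.inr j))

lemma sum_Acl_sq (N : ℕ) : ∑ k : Fin N, (Acl k : PR N) ^ 2 = psq N * Dis N := by
  simp_rw [Acl_eq]
  rw [aux_AA (fun j => (X (Sum.inl j) : PR N)) (fun j => X (Sum.inr j))]
  simp only [Dis, psq]
  ring

lemma sum_Acl_Mang {N : ℕ} (j : Fin N) :
    ∑ i : Fin N, (Acl i : PR N) * Mang i j = - (Dis N * X (Sum.inr j)) := by
  simp_rw [Acl_eq, Mang]
  rw [aux_AM (fun j => (X (Sum.inl j) : PR N)) (fun j => X (Sum.inr j))]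
  simp only [Dis, psq]
  ring

lemma Acl_rel {N : ℕ} (i j k : Fin N) :
    (Mang i j : PR N) * Acl k = Acl j * Mang i k - Acl i * Mang j k := by
  simp only [Acl_eq, Mang]; ring

lemma Mang_rel {N : ℕ} (a i k l : Fin N) :
    (Mang a k : PR N) * Mang i l = Mang a i * Mang k l + Mang a l * Mang i k := by
  simp only [Mang]; ring

/-- Evaluation at `x = e_a`, `p = e_b`. -/
def ev {N : ℕ} (a b : Fin N) : PR N →ₐ[ℂ] ℂ :=
  aeval (Sum.elim (fun i => if i = a then 1 else 0) (fun i => if i = b then 1 else 0))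

lemma ev_Mang {N : ℕ} (a b c : Fin N) (hab : a ≠ b) :
    ev a b (Mang a c) = if c = b then 1 else 0 := by
  simp [ev, Mang, hab]

lemma Mang_ne {N : ℕ} (a b : Fin N) (hab : a ≠ b) : (Mang a b : PR N) ≠ 0 := by
  intro h
  have := ev_Mang a b b hab
  simp [h] at this

lemma sum_Mang_ne {N : ℕ} (a b : Fin N) (hab : a ≠ b) : ∑ k, (Mang a k : PR N) ^ 2 ≠ 0 := by
  intro h
  have := congrArg (ev a b) h
  simp [ev_Mang _ _ _ hab] at this

lemma Dis_ne {N : ℕ} (a b : Fin N) (hab : a ≠ b) : Dis N ≠ 0 := by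
  intro h
  have := congrArg (ev a b) h
  simp [ev, Dis, hab.symm] at this

lemma X_ne {N : ℕ} (a : Fin N ⊕ Fin N) : (X a : PR N) ≠ 0 := X_ne_zero a

lemma core {N : ℕ} (hN : 2 ≤ N) (K : Subalgebra ℂ (PR N))
    (hmul : ∀ y z, y ≠ 0 → y ∈ K → y * z ∈ K → z ∈ K) (hsq : ∀ z, z ^ 2 ∈ K → z ∈ K)
    (h : ∀ i, fam18 N hN i ∈ K) :
    psq N ∈ K ∧ (∀ j k : Fin N, Mang j k ∈ K) ∧ Dis N ∈ K ∧ ∀ i : Fin N, Acl i ∈ K := by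
  have hp : psq N ∈ K := h (Sum.inl ())
  have anti : ∀ j k : Fin N, (Mang j k : PR N) = - Mang k j := fun j k => by
    simp only [Mang]; ring
  have h0 : ∀ k : Fin N, Mang ⟨0, by omega⟩ k ∈ K := by
    intro k
    by_cases hk : 1 ≤ (k : ℕ)
    · exact h (Sum.inr (Sum.inr (Sum.inl ⟨k, hk⟩)))
    · have : k = ⟨0, by omega⟩ := Fin.ext (by simp; omega)
      rw [this]
      simp [Mang]
  have hlt : ∀ (l : ℕ) (hl : l < N) (i : Fin N), (i : ℕ) < l → Mang i ⟨l, hl⟩ ∈ K := by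
    intro l
    induction l with
    | zero => intro _ _ h; omega
    | succ k ih =>
      intro hl i hi
      by_cases hi0 : (i : ℕ) = 0
      · have : i = ⟨0, by omega⟩ := Fin.ext hi0
        rw [this]; exact h0 _
      have hk : Mang (⟨k, by omega⟩ : Fin N) ⟨k + 1, hl⟩ ∈ K :=
        h (Sum.inr (Sum.inr (Sum.inr ⟨⟨k, by omega⟩, by simp; omega, by simp; omega⟩)))
      by_cases hik : (i : ℕ) = k
      · have : i = ⟨k, by omega⟩ := Fin.ext hik
        rw [this]; exact hk
      refine hmul (Mang ⟨0, by omega⟩ ⟨k, by omega⟩) _ (Mang_ne _ _ ?_) (h0 _) ?_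
      · intro h; simp at h; omega
      rw [Mang_rel]
      exact K.add_mem (K.mul_mem (h0 _) hk) (K.mul_mem (h0 _) (ih _ i (by omega)))
  have hM : ∀ j k : Fin N, Mang j k ∈ K := by
    intro j k
    rcases lt_trichotomy j k with hjk | rfl | hjk
    · exact hlt k k.2 j hjk
    · simp [Mang]
    · rw [anti]; exact K.neg_mem (hlt j j.2 k hjk)
  have hD : Dis N ∈ K := by
    refine hmul 2 _ two_ne_zero (ofNat_mem K 2) ?_
    rw [← sum_Mang_sq]
    exact K.sum_mem fun j _ => K.sum_mem fun k _ => K.pow_mem (hM _ _) 2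
  have hA0 : Acl (⟨0, by omega⟩ : Fin N) ∈ K := h (Sum.inr (Sum.inl ()))
  have h01 : (⟨0, by omega⟩ : Fin N) ≠ ⟨1, by omega⟩ := by simp
  generalize (⟨0, by omega⟩ : Fin N) = a at hA0 h01
  generalize (⟨1, by omega⟩ : Fin N) = b at h01
  have hA1 : Acl b ∈ K := by
    have hα : ∑ k, (Mang a k : PR N) ^ 2 ∈ K := K.sum_mem fun k _ => K.pow_mem (hM _ _) 2
    have hγ : ∑ k, (Mang b k : PR N) ^ 2 ∈ K := K.sum_mem fun k _ => K.pow_mem (hM _ _) 2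
    have hβ : ∑ k, (Mang a k : PR N) * Mang b k ∈ K :=
      K.sum_mem fun k _ => K.mul_mem (hM _ _) (hM _ _)
    have key : (Mang a b : PR N) ^ 2 * (psq N * Dis N) = Acl b ^ 2 * (∑ k, Mang a k ^ 2)
        - 2 * Acl b * Acl a * (∑ k, Mang a k * Mang b k) + Acl a ^ 2 * ∑ k, Mang b k ^ 2 := by
      rw [← aux_quad, ← sum_Acl_sq, mul_sum]
      exact sum_congr rfl fun k _ => by rw [← Acl_rel]; ring
    have hne := sum_Mang_ne a b h01
    generalize ∑ k, (Mang a k : PR N) ^ 2 = α at *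
    generalize ∑ k, (Mang b k : PR N) ^ 2 = γ at *
    generalize ∑ k, (Mang a k : PR N) * Mang b k = β at *
    have h2 : α * Acl b - Acl a * β ∈ K := by
      apply hsq
      have : (α * Acl b - Acl a * β) ^ 2
          = α * (Mang a b ^ 2 * (psq N * Dis N) - Acl a ^ 2 * γ) + Acl a ^ 2 * β ^ 2 := by
        rw [key]; ring
      rw [this]
      exact K.add_mem (K.mul_mem hα (K.sub_mem (K.mul_mem (K.pow_mem (hM _ _) 2)
        (K.mul_mem hp hD)) (K.mul_mem (K.pow_mem hA0 2) hγ)))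
        (K.mul_mem (K.pow_mem hA0 2) (K.pow_mem hβ 2))
    refine hmul α _ hne hα ?_
    have := K.add_mem h2 (K.mul_mem hA0 hβ)
    simpa using this
  refine ⟨hp, hM, hD, fun i => hmul (Mang a b) _ (Mang_ne _ _ h01) (hM _ _) ?_⟩
  rw [Acl_rel]
  exact K.sub_mem (K.mul_mem hA1 (hM _ _)) (K.mul_mem hA0 (hM _ _))

lemma core2 {N : ℕ} (hN : 2 ≤ N) (K : Subalgebra ℂ (PR N))
    (hmul : ∀ y z, y ≠ 0 → y ∈ K → y * z ∈ K → z ∈ K) (hsq : ∀ z, z ^ 2 ∈ K → z ∈ K)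
    (h : ∀ i, fam18 N hN i ∈ K) (hx : X (Sum.inl ⟨0, by omega⟩) ∈ K) : K = ⊤ := by
  obtain ⟨-, hM, hD, hA⟩ := core hN K hmul hsq h
  have h01 : (⟨0, by omega⟩ : Fin N) ≠ ⟨1, by omega⟩ := by simp
  have hpj : ∀ j : Fin N, X (Sum.inr j) ∈ K := by
    intro j
    refine hmul _ _ (Dis_ne _ _ h01) hD ?_
    rw [← neg_neg (Dis N * X (Sum.inr j)), ← sum_Acl_Mang]
    exact K.neg_mem (K.sum_mem fun i _ => K.mul_mem (hA _) (hM _ _))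
  have hxj : ∀ j : Fin N, X (Sum.inl j) ∈ K := by
    intro j
    refine hmul (X (Sum.inr ⟨0, by omega⟩)) _ (X_ne_zero _) (hpj _) ?_
    have : (X (Sum.inr ⟨0, by omega⟩) * X (Sum.inl j) : PR N)
        = X (Sum.inl ⟨0, by omega⟩) * X (Sum.inr j) - Mang ⟨0, by omega⟩ j := by
      simp only [Mang]; ring
    rw [this]
    exact K.sub_mem (K.mul_mem hx (hpj _)) (hM _ _)
  rw [eq_top_iff, ← MvPolynomial.adjoin_range_X, Algebra.adjoin_le_iff]
  rintro _ ⟨i | i, rfl⟩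
  · exact hxj i
  · exact hpj i

/-- Elements algebraic over `ℂ[s]`. -/
def algK {N : ℕ} (s : Set (PR N)) : Subalgebra ℂ (PR N) :=
  (Subalgebra.algebraicClosure (Algebra.adjoin ℂ s) (PR N)).restrictScalars ℂ

lemma mem_algK {N : ℕ} (s : Set (PR N)) (z : PR N) :
    z ∈ algK s ↔ IsAlgebraic (Algebra.adjoin ℂ s) z := Iff.rfl

lemma algK_mul {N : ℕ} (s : Set (PR N)) (y z : PR N) (hy : y ≠ 0) (h : y ∈ algK s)
    (h' : y * z ∈ algK s) : z ∈ algK s :=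
  IsAlgebraic.of_mul (mem_nonZeroDivisors_of_ne_zero hy) h h'

lemma algK_sq {N : ℕ} (s : Set (PR N)) (z : PR N) (h : z ^ 2 ∈ algK s) : z ∈ algK s :=
  IsAlgebraic.of_pow two_pos h

lemma subset_algK {N : ℕ} (s : Set (PR N)) (z : PR N) (h : z ∈ s) : z ∈ algK s :=
  isAlgebraic_algebraMap (⟨z, Algebra.subset_adjoin h⟩ : Algebra.adjoin ℂ s)

lemma card_idx (N : ℕ) (hN : 2 ≤ N) : Nat.card (Option (Idx18 N)) ≤ 2 * N := by
  have h1 : Nat.card { j : Fin N // 1 ≤ (j : ℕ) } ≤ N - 1 := by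
    have := Nat.card_le_card_of_injective
      (fun j : { j : Fin N // 1 ≤ (j : ℕ) } => (⟨j.1 - 1, by omega⟩ : Fin (N - 1)))
      (fun i j h => by
        simp only [Fin.mk.injEq] at h
        exact Subtype.ext (Fin.ext (by have := i.2; have := j.2; omega)))
    simpa using this
  have h2 : Nat.card { j : Fin N // 1 ≤ (j : ℕ) ∧ (j : ℕ) ≤ N - 2 } ≤ N - 2 := by
    have := Nat.card_le_card_of_injective
      (fun j : { j : Fin N // 1 ≤ (j : ℕ) ∧ (j : ℕ) ≤ N - 2 } =>
        (⟨j.1 - 1, by have := j.2; omega⟩ : Fin (N - 2)))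
      (fun i j h => by
        simp only [Fin.mk.injEq] at h
        exact Subtype.ext (Fin.ext (by have := i.2; have := j.2; omega)))
    simpa using this
  rw [Finite.card_option, Nat.card_sum, Nat.card_sum, Nat.card_sum]
  simp only [Nat.card_unique]
  omega

lemma indep (N : ℕ) (hN : 2 ≤ N) : AlgebraicIndependent ℂ (fam18 N hN) := by
  let g : Option (Idx18 N) → PR N := fun o => o.elim (X (Sum.inl ⟨0, by omega⟩)) (fam18 N hN)
  have htop : algK (Set.range g) = ⊤ :=
    core2 hN _ (algK_mul _) (algK_sq _) (fun i => subset_algK _ _ ⟨some i, rfl⟩)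
      (subset_algK _ _ ⟨none, rfl⟩)
  have : Algebra.IsAlgebraic (Algebra.adjoin ℂ (Set.range g)) (PR N) :=
    ⟨fun z => (mem_algK _ z).1 (htop ▸ Algebra.mem_top)⟩
  have hb : IsTranscendenceBasis ℂ g := by
    apply Algebra.IsAlgebraic.isTranscendenceBasis_of_le_trdeg_of_finite
    rw [MvPolynomial.trdeg_of_isDomain]
    rw [← Nat.cast_card]
    have := card_idx N hN
    have h2 : ((Nat.card (Option (Idx18 N)) : ℕ) : Cardinal) ≤ ((2 * N : ℕ) : Cardinal) := by
      exact_mod_cast this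
    refine h2.trans (le_of_eq ?_)
    simp [two_mul]
  exact hb.1.comp some (Option.some_injective _)

theorem statement18 (N : ℕ) (hN : 2 ≤ N) :
    AlgebraicIndependent ℂ (fam18 N hN) ∧
      ∀ z : PR N, z ∈ Rcl N →
        IsAlgebraic ↥(Algebra.adjoin ℂ (Set.range (fam18 N hN))) z := by
  refine ⟨indep N hN, fun z hz => ?_⟩
  obtain ⟨hp, hM, -, hA⟩ := core hN (algK (Set.range (fam18 N hN))) (algK_mul _) (algK_sq _)
    (fun i => subset_algK _ _ ⟨i, rfl⟩)
  have hle : Rcl N ≤ algK (Set.range (fam18 N hN)) := by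
    refine Algebra.adjoin_le ?_
    rintro q ((rfl | ⟨i, rfl⟩) | ⟨j, k, -, rfl⟩)
    · exact hp
    · exact hA i
    · exact hM j k
  exact (mem_algK _ z).1 (hle hz)
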